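/- Suppose the data (V,g,ε,ξ,η,φ,h,R) satisfies the (κ,μ)-nullity condition, Identity (φR), Identity (hR), εκ < 1 and h² = (εκ−1)φ². Define the Ricci form Ric(X,Y) := trace(Z ↦ R(Z,X)Y). Then for all X,Y ∈ V: Ric(X,Y) = ε[2(n−1) − nμ]·g(X,Y) + [2(n−1) + μ]·g(hX,Y) + [2(1−n)ε + 2nκ + nεμ]·η(X)η(Y). Equivalently, the Ricci operator Q (defined by g(QX,Y) = Ric(X,Y)) satisfies QX = ε[2(n−1) − nμ]X + (2(n−1)+μ)hX + [2(1−n)ε + 2nκ + nεμ]η(X)ξ. (Theorem 3.8(iii).) -/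

import Mathlib

section Traces

open LinearMap Module

variable {V : Type*} [AddCommGroup V] [Module ℝ V] [FiniteDimensional ℝ V]

/-- Endomorphisms that are adjoint to each other have the same trace. -/
theorem trace_eq_of_adjoint {g : LinearMap.BilinForm ℝ V} (hg : g.Nondegenerate)
    {A B : V →ₗ[ℝ] V} (hAB : ∀ X Y, g (A X) Y = g X (B Y)) :
    trace ℝ V A = trace ℝ V B := by
  have key : Module.Dual.transpose (R := ℝ) B = (g.toDual hg).conj A := by
    ext f Y
    obtain ⟨X, rfl⟩ := (g.toDual hg).surjective f
    simp [LinearEquiv.conj_apply, Module.Dual.transpose, LinearMap.BilinForm.toDual_def, hAB]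
  rw [← trace_transpose' B, key, trace_conj']

/-- The trace of `A ∘ K`, where `K` is the defect of the commutation of the curvature with `φ`. -/
theorem trace_comp_phi_defect (g : LinearMap.BilinForm ℝ V) (ε κ μ : ℝ) (ξ : V) (η : V →ₗ[ℝ] ℝ)
    (φ h A K : V →ₗ[ℝ] V) (Y Z : V)
    (hK : ∀ X, K X =
      ((1 - ε * κ) * (η X * g (φ Y) Z - η Y * g (φ X) Z)
         + ε * (1 - μ) * (η X * g (φ (h Y)) Z - η Y * g (φ (h X)) Z)) • ξ
      - g (Y + ε • h Y) Z • (ε • φ X + φ (h X))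
      + g (X + ε • h X) Z • (ε • φ Y + φ (h Y))
      - g (ε • φ Y + φ (h Y)) Z • (X + ε • h X)
      + g (ε • φ X + φ (h X)) Z • (Y + ε • h Y)
      - η Z • ((1 - ε * κ) • (η X • φ Y - η Y • φ X)
         + (ε * (1 - μ)) • (η X • φ (h Y) - η Y • φ (h X)))) :
    trace ℝ V (A ∘ₗ K) =
      (1 - ε * κ) * (η (A ξ) * g (φ Y) Z - η Y * g (φ (A ξ)) Z)
      + ε * (1 - μ) * (η (A ξ) * g (φ (h Y)) Z - η Y * g (φ (h (A ξ))) Z)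
      - g (Y + ε • h Y) Z * (ε * trace ℝ V (A ∘ₗ φ) + trace ℝ V (A ∘ₗ φ ∘ₗ h))
      + g (A (ε • φ Y + φ (h Y)) + ε • h (A (ε • φ Y + φ (h Y)))) Z
      - g (ε • φ Y + φ (h Y)) Z * (trace ℝ V A + ε * trace ℝ V (A ∘ₗ h))
      + g (ε • φ (A (Y + ε • h Y)) + φ (h (A (Y + ε • h Y)))) Z
      - η Z * ((1 - ε * κ) * (η (A (φ Y)) - η Y * trace ℝ V (A ∘ₗ φ))
         + ε * (1 - μ) * (η (A (φ (h Y))) - η Y * trace ℝ V (A ∘ₗ φ ∘ₗ h))) := by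
  have key : A ∘ₗ K =
      (((1 - ε * κ) • (g (φ Y) Z • η - η Y • (LinearMap.flip g Z ∘ₗ φ))
        + (ε * (1 - μ)) • (g (φ (h Y)) Z • η - η Y • (LinearMap.flip g Z ∘ₗ φ ∘ₗ h))).smulRight (A
          ξ)
      - g (Y + ε • h Y) Z • (ε • (A ∘ₗ φ) + A ∘ₗ φ ∘ₗ h)
      + (LinearMap.flip g Z + ε • (LinearMap.flip g Z ∘ₗ h)).smulRight (A (ε • φ Y + φ (h Y)))
      - g (ε • φ Y + φ (h Y)) Z • (A + ε • (A ∘ₗ h))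
      + (ε • (LinearMap.flip g Z ∘ₗ φ) + LinearMap.flip g Z ∘ₗ φ ∘ₗ h).smulRight (A (Y + ε • h Y))
      - η Z • ((1 - ε * κ) • (η.smulRight (A (φ Y)) - η Y • (A ∘ₗ φ))
        + (ε * (1 - μ)) • (η.smulRight (A (φ (h Y))) - η Y • (A ∘ₗ φ ∘ₗ h)))) := by
    ext X
    simp only [comp_apply, hK, map_add, map_sub, map_smul, LinearMap.add_apply, LinearMap.sub_apply,
      LinearMap.smul_apply,
      smulRight_apply, flip_apply, smul_eq_mul]
    module
  rw [key]
  simp only [map_add, map_sub, map_smul, trace_smulRight, LinearMap.add_apply, LinearMap.sub_apply,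
    LinearMap.smul_apply,
    comp_apply, flip_apply, smul_eq_mul]
  ring

/-- The trace, in the first curvature slot, of the defect of the commutation with `h`. -/
theorem trace_h_defect_left (g : LinearMap.BilinForm ℝ V) (ε κ μ : ℝ) (ξ : V) (η : V →ₗ[ℝ] ℝ)
    (φ h K : V →ₗ[ℝ] V) (Y Z : V)
    (hK : ∀ X, K X =
      (κ * (η X * g (h Y) Z - η Y * g (h X) Z)
         + μ * (ε * κ - 1) * (η Y * g X Z - η X * g Y Z)) • ξ
      + κ • (g Y (φ Z) • φ (h X) - g X (φ Z) • φ (h Y) + g Z (φ (h Y)) • φ X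
         - g Z (φ (h X)) • φ Y + (ε * η Z) • (η X • h Y - η Y • h X))
      - μ • (η Y • (((ε - κ) * η Z) • X + (μ * η X) • h Z)
         - η X • (((ε - κ) * η Z) • Y + (μ * η Y) • h Z)
         + (2 * ε * g X (φ Y)) • φ (h Z))) :
    trace ℝ V K =
      κ * (η ξ * g (h Y) Z - η Y * g (h ξ) Z)
         + μ * (ε * κ - 1) * (η Y * g ξ Z - η ξ * g Y Z)
      + κ * (g Y (φ Z) * trace ℝ V (φ ∘ₗ h) - g (φ (h Y)) (φ Z) + g Z (φ (h Y)) * trace ℝ V φ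
         - g Z (φ (h (φ Y))) + (ε * η Z) * (η (h Y) - η Y * trace ℝ V h))
      - μ * (η Y * ((ε - κ) * η Z * finrank ℝ V + μ * η (h Z))
         - ((ε - κ) * η Z * η Y + μ * η Y * η (h Z))
         + 2 * ε * g (φ (h Z)) (φ Y)) := by
  have key : K =
      (κ • (g (h Y) Z • η - η Y • (LinearMap.flip g Z ∘ₗ h))
        + (μ * (ε * κ - 1)) • (η Y • LinearMap.flip g Z - g Y Z • η)).smulRight ξ
      + κ • (g Y (φ Z) • (φ ∘ₗ h) - (LinearMap.flip g (φ Z)).smulRight (φ (h Y)) + g Z (φ (h Y)) • φ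
        - (g Z ∘ₗ φ ∘ₗ h).smulRight (φ Y) + (ε * η Z) • (η.smulRight (h Y) - η Y • h))
      - μ • (η Y • (((ε - κ) * η Z) • LinearMap.id + (μ • η).smulRight (h Z))
        - (((ε - κ) * η Z) • η.smulRight Y + (μ * η Y) • η.smulRight (h Z))
        + ((2 * ε) • LinearMap.flip g (φ Y)).smulRight (φ (h Z))) := by
    ext X
    simp only [comp_apply, hK, LinearMap.add_apply, LinearMap.sub_apply, LinearMap.smul_apply,
      id_apply,
      smulRight_apply, flip_apply, smul_eq_mul]
    module
  rw [key]
  simp only [map_add, map_sub, map_smul, trace_smulRight, LinearMap.add_apply, LinearMap.sub_apply,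
    LinearMap.smul_apply,
    comp_apply, flip_apply, smul_eq_mul, trace_id]
  ring

/-- The trace, in the third curvature slot, of the defect of the commutation with `h`. -/
theorem trace_h_defect_comp (g : LinearMap.BilinForm ℝ V) (ε κ μ : ℝ) (ξ : V) (η : V →ₗ[ℝ] ℝ)
    (φ h A K : V →ₗ[ℝ] V) (X Y : V)
    (hK : ∀ Z, K Z =
      (κ * (η X * g (h Y) Z - η Y * g (h X) Z)
         + μ * (ε * κ - 1) * (η Y * g X Z - η X * g Y Z)) • ξ
      + κ • (g Y (φ Z) • φ (h X) - g X (φ Z) • φ (h Y) + g Z (φ (h Y)) • φ X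
         - g Z (φ (h X)) • φ Y + (ε * η Z) • (η X • h Y - η Y • h X))
      - μ • (η Y • (((ε - κ) * η Z) • X + (μ * η X) • h Z)
         - η X • (((ε - κ) * η Z) • Y + (μ * η Y) • h Z)
         + (2 * ε * g X (φ Y)) • φ (h Z))) :
    trace ℝ V (K ∘ₗ A) =
      κ * (η X * g (h Y) (A ξ) - η Y * g (h X) (A ξ))
         + μ * (ε * κ - 1) * (η Y * g X (A ξ) - η X * g Y (A ξ))
      + κ * (g Y (φ (A (φ (h X)))) - g X (φ (A (φ (h Y)))) + g (A (φ X)) (φ (h Y))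
         - g (A (φ Y)) (φ (h X)) + ε * (η X * η (A (h Y)) - η Y * η (A (h X))))
      - μ * (η Y * ((ε - κ) * η (A X)) - η X * ((ε - κ) * η (A Y))
         + 2 * ε * g X (φ Y) * trace ℝ V (φ ∘ₗ h ∘ₗ A)) := by
  have key : K ∘ₗ A =
      (κ • (η X • (g (h Y) ∘ₗ A) - η Y • (g (h X) ∘ₗ A))
        + (μ * (ε * κ - 1)) • (η Y • (g X ∘ₗ A) - η X • (g Y ∘ₗ A))).smulRight ξ
      + κ • ((g Y ∘ₗ φ ∘ₗ A).smulRight (φ (h X)) - (g X ∘ₗ φ ∘ₗ A).smulRight (φ (h Y))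
        + (LinearMap.flip g (φ (h Y)) ∘ₗ A).smulRight (φ X) - (LinearMap.flip g (φ (h X)) ∘ₗ
          A).smulRight (φ Y)
        + ε • (η X • (η ∘ₗ A).smulRight (h Y) - η Y • (η ∘ₗ A).smulRight (h X)))
      - μ • (η Y • ((ε - κ) • (η ∘ₗ A).smulRight X)
        - η X • ((ε - κ) • (η ∘ₗ A).smulRight Y)
        + (2 * ε * g X (φ Y)) • (φ ∘ₗ h ∘ₗ A)) := by
    ext Z
    simp only [comp_apply, hK, LinearMap.add_apply, LinearMap.sub_apply, LinearMap.smul_apply,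
      smulRight_apply, flip_apply, smul_eq_mul]
    module
  rw [key]
  simp only [map_add, map_sub, map_smul, trace_smulRight, LinearMap.add_apply, LinearMap.sub_apply,
    LinearMap.smul_apply,
    comp_apply, flip_apply, smul_eq_mul]

end Traces

open LinearMap Module in
theorem stmt_10
    {V : Type*} [AddCommGroup V] [Module ℝ V] [FiniteDimensional ℝ V]
    (n : ℕ) (hn : 1 ≤ n)
    (hdim : Module.finrank ℝ V = 2 * n + 1)
    (g : LinearMap.BilinForm ℝ V)
    (hg_symm : ∀ X Y : V, g X Y = g Y X)
    (hg_nd : g.Nondegenerate)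
    (ε : ℝ) (hε : ε = 1 ∨ ε = -1)
    (ξ : V) (hξ : g ξ ξ = ε)
    (η : V → ℝ) (hη : ∀ X : V, η X = ε * g ξ X)
    (φ : V →ₗ[ℝ] V)
    (hφ_sq : ∀ X : V, φ (φ X) = -X + η X • ξ)
    (hφ_g : ∀ X Y : V, g (φ X) (φ Y) = g X Y - ε * η X * η Y)
    (h : V →ₗ[ℝ] V)
    (hh_sym : ∀ X Y : V, g (h X) Y = g X (h Y))
    (hh_ξ : h ξ = 0)
    (hhφ : ∀ X : V, h (φ X) = - φ (h X))
    (R : V →ₗ[ℝ] V →ₗ[ℝ] V →ₗ[ℝ] V)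
    (hR_skew1 : ∀ X Y Z W : V, g (R X Y Z) W = - g (R Y X Z) W)
    (hR_skew2 : ∀ X Y Z W : V, g (R X Y Z) W = - g (R X Y W) Z)
    (hR_pair : ∀ X Y Z W : V, g (R X Y Z) W = g (R Z W X) Y)
    (hR_bianchi : ∀ X Y Z : V, R X Y Z + R Y Z X + R Z X Y = 0)
    (κ μ : ℝ)
    (hnull : ∀ X Y : V, R X Y ξ
      = (ε * κ) • (η Y • X - η X • Y) + (ε * μ) • (η Y • h X - η X • h Y))
    (hφR : ∀ X Y Z : V, R X Y (φ Z) = φ (R X Y Z)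
      + ((1 - ε * κ) * (η X * g (φ Y) Z - η Y * g (φ X) Z)
         + ε * (1 - μ) * (η X * g (φ (h Y)) Z - η Y * g (φ (h X)) Z)) • ξ
      - g (Y + ε • h Y) Z • (ε • φ X + φ (h X))
      + g (X + ε • h X) Z • (ε • φ Y + φ (h Y))
      - g (ε • φ Y + φ (h Y)) Z • (X + ε • h X)
      + g (ε • φ X + φ (h X)) Z • (Y + ε • h Y)
      - η Z • ((1 - ε * κ) • (η X • φ Y - η Y • φ X)
         + (ε * (1 - μ)) • (η X • φ (h Y) - η Y • φ (h X))))
    (hhR : ∀ X Y Z : V, R X Y (h Z) - h (R X Y Z)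
      = (κ * (η X * g (h Y) Z - η Y * g (h X) Z)
         + μ * (ε * κ - 1) * (η Y * g X Z - η X * g Y Z)) • ξ
      + κ • (g Y (φ Z) • φ (h X) - g X (φ Z) • φ (h Y) + g Z (φ (h Y)) • φ X
         - g Z (φ (h X)) • φ Y + (ε * η Z) • (η X • h Y - η Y • h X))
      - μ • (η Y • (((ε - κ) * η Z) • X + (μ * η X) • h Z)
         - η X • (((ε - κ) * η Z) • Y + (μ * η Y) • h Z)
         + (2 * ε * g X (φ Y)) • φ (h Z)))
    (hκ : ε * κ < 1)
    (hh2 : ∀ X : V, h (h X) = (ε * κ - 1) • φ (φ X)) :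
    (∀ X Y : V, LinearMap.trace ℝ V ((R.flip X).flip Y)
      = ε * (2 * ((n : ℝ) - 1) - (n : ℝ) * μ) * g X Y
        + (2 * ((n : ℝ) - 1) + μ) * g (h X) Y
        + (2 * (1 - (n : ℝ)) * ε + 2 * (n : ℝ) * κ + (n : ℝ) * ε * μ) * (η X * η Y)) ∧
    (∀ Q : V →ₗ[ℝ] V,
      (∀ X Y : V, g (Q X) Y = LinearMap.trace ℝ V ((R.flip X).flip Y)) →
      ∀ X : V, Q X = (ε * (2 * ((n : ℝ) - 1) - (n : ℝ) * μ)) • X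
        + (2 * ((n : ℝ) - 1) + μ) • h X
        + ((2 * (1 - (n : ℝ)) * ε + 2 * (n : ℝ) * κ + (n : ℝ) * ε * μ) * η X) • ξ) := by
  have hεε : ε * ε = 1 := by rcases hε with rfl | rfl <;> norm_num
  obtain ⟨η, rfl⟩ : ∃ e : V →ₗ[ℝ] ℝ, ⇑e = η := ⟨ε • g ξ, by ext X; simp [hη]⟩
  have hgξ (X : V) : g ξ X = ε * η X := by rw [hη]; linear_combination -hεε * g ξ X
  have hgξ' (X : V) : g X ξ = ε * η X := by rw [hg_symm, hgξ]
  have hηξ : η ξ = 1 := by rw [hη, hξ, hεε]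
  have hφξ : φ ξ = 0 := by
    have h1 : φ (φ ξ) = 0 := by simp [hφ_sq, hηξ]
    have h2 : φ ξ = η (φ ξ) • ξ := by
      have := hφ_sq (φ ξ)
      rw [h1, map_zero] at this
      exact (neg_add_eq_zero.1 this.symm)
    have h3 : η (φ (φ ξ)) = η (φ ξ) * η (φ ξ) := by
      conv_lhs => rw [h2, map_smul, map_smul, smul_eq_mul]
    rw [h1, map_zero, eq_comm, mul_self_eq_zero] at h3
    rw [h2, h3, zero_smul]
  have hηφ (X : V) : η (φ X) = 0 := by
    have h1 := hφ_sq (φ X)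
    rw [hφ_sq X, map_add, map_neg, map_smul, hφξ, smul_zero, add_zero, left_eq_add] at h1
    simpa [hηξ] using congrArg η h1
  have hηh (X : V) : η (h X) = 0 := by rw [hη, ← hh_sym, hh_ξ]; simp
  have hφ_skew (X Y : V) : g (φ X) Y = -g X (φ Y) := by
    have h1 := hφ_g X (φ Y)
    rw [hφ_sq, hηφ, map_add, map_smul, hgξ', hηφ] at h1
    simp only [map_neg, smul_eq_mul, mul_zero, add_zero, sub_zero] at h1
    linarith
  -- traces of the words in `φ` and `h`
  have hhh (X : V) : h (h X) = (1 - ε * κ) • (X - η X • ξ) := by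
    rw [hh2, hφ_sq]; module
  have tφh : trace ℝ V (φ ∘ₗ h) = 0 := by
    have h1 : h ∘ₗ φ = -(φ ∘ₗ h) := by ext X; simp [hhφ]
    have h2 := trace_comp_comm' φ h
    rw [h1, map_neg] at h2
    linarith
  have thφ : trace ℝ V (h ∘ₗ φ) = 0 := by rw [trace_comp_comm', tφh]
  have tφφ : trace ℝ V (φ ∘ₗ φ) = -(2 * n) := by
    have h1 : φ ∘ₗ φ = -LinearMap.id + η.smulRight ξ := by ext X; simp [hφ_sq]
    rw [h1, map_add, map_neg, trace_id, trace_smulRight, hηξ, hdim]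
    push_cast; ring
  have thφφ : h ∘ₗ φ ∘ₗ φ = -h := by ext X; simp [hφ_sq, hh_ξ]
  have tφφh : φ ∘ₗ φ ∘ₗ h = -h := by ext X; simp [hφ_sq, hηh]
  have tφhφ : φ ∘ₗ h ∘ₗ φ = h := by ext X; simp [hhφ, hφ_sq, hηh]
  have th : trace ℝ V h = 0 := by
    have h1 := trace_comp_comm' φ (h ∘ₗ φ)
    rw [tφhφ, comp_assoc, thφφ, map_neg] at h1
    linarith
  have hthh : h ∘ₗ h = (ε * κ - 1) • (φ ∘ₗ φ) := by ext X; simp [hh2]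
  have thh : trace ℝ V (h ∘ₗ h) = (1 - ε * κ) * (2 * n) := by
    rw [hthh, map_smul, tφφ, smul_eq_mul]; ring
  have hφhh : φ ∘ₗ h ∘ₗ h = (1 - ε * κ) • φ := by ext X; simp [hhh, hφξ]
  have hhφh : h ∘ₗ φ ∘ₗ h = -((1 - ε * κ) • φ) := by ext X; simp [hhφ, hhh, hφξ]
  have tφ : trace ℝ V φ = 0 := by
    have h1 := trace_comp_comm' h (φ ∘ₗ h)
    rw [hhφh, comp_assoc, hφhh, map_neg, map_smul, smul_eq_mul] at h1
    have h2 : (1 - ε * κ) * trace ℝ V φ = 0 := by linarith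
    exact (mul_eq_zero.1 h2).resolve_left (by linarith)
  have hRξξ (Y Z : V) : η (R ξ Y Z) = κ * (g Y Z - ε * η Y * η Z) + μ * g (h Y) Z := by
    rw [hη, hg_symm, hR_skew2, hnull]
    simp only [hηξ, hh_ξ, hgξ, map_add, map_sub, map_smul, LinearMap.add_apply,
      LinearMap.sub_apply, LinearMap.smul_apply, map_zero, LinearMap.zero_apply, smul_eq_mul]
    linear_combination (κ * (g Y Z - ε * η Y * η Z) + μ * g (h Y) Z) * hεε
  -- the `φ`-identity is incompatible with a timelike Reeb vector
  obtain rfl : ε = 1 := by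
    refine hε.resolve_right fun hε' => ?_
    subst hε'
    have h1 (Y : V) : (2 * (1 + κ)) • φ Y + (2 * (μ - 1)) • φ (h Y) = 0 := by
      refine hg_nd.1 _ fun Z => ?_
      have h2 := congrArg η (hφR ξ Y Z)
      rw [hRξξ] at h2
      simp only [map_add, map_sub, map_smul, hηφ, hηh, hηξ, hφξ, hh_ξ, hφ_skew,
        LinearMap.add_apply, LinearMap.smul_apply, smul_eq_mul, map_zero, mul_zero,
        LinearMap.zero_apply] at h2 ⊢
      linarith
    have h2 : (2 * (1 + κ)) • (φ ∘ₗ φ) + (2 * (μ - 1)) • (φ ∘ₗ φ ∘ₗ h) = 0 := by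
      ext Y; simpa using congrArg φ (h1 Y)
    have h3 := congrArg (trace ℝ V) h2
    rw [map_add, map_smul, map_smul, tφφ, tφφh, map_neg, th, map_zero] at h3
    have hn' : (1 : ℝ) ≤ n := by exact_mod_cast hn
    simp only [smul_eq_mul, neg_zero, mul_zero, add_zero] at h3
    nlinarith
  simp only [one_mul] at hκ hη hgξ hgξ' hhh hthh thh hφhh hhφh hRξξ hnull
  have hφhhφ : φ ∘ₗ h ∘ₗ h ∘ₗ φ = (1 - κ) • (φ ∘ₗ φ) := by ext X; simp [hhh, hηφ]
  have hric_ξ (Y : V) : trace ℝ V ((R.flip Y).flip ξ) = 2 * n * κ * η Y := by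
    have h1 : (R.flip Y).flip ξ = κ • (η Y • LinearMap.id - η.smulRight Y)
        + μ • (η Y • h - η.smulRight (h Y)) := by
      ext X; simp [hnull]
    rw [h1]
    simp only [map_add, map_sub, map_smul, trace_id, trace_smulRight, th, hηh, hdim, smul_eq_mul]
    push_cast; ring
  have hric_symm (Y Z : V) :
      trace ℝ V ((R.flip Y).flip Z) = trace ℝ V ((R.flip Z).flip Y) := by
    refine trace_eq_of_adjoint hg_nd fun X W => ?_
    rw [hg_symm X]
    simp only [flip_apply]
    rw [hR_pair, hR_skew1, hR_skew2, neg_neg]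
  have hric_h_symm (Y Z : V) :
      trace ℝ V (h ∘ₗ (R.flip Y).flip Z) = trace ℝ V (h ∘ₗ (R.flip Z).flip Y) := by
    rw [trace_comp_comm' ((R.flip Y).flip Z) h]
    refine trace_eq_of_adjoint hg_nd fun X W => ?_
    simp only [flip_apply, comp_apply]
    rw [← hh_sym X, hg_symm (h X), hR_pair, hR_skew1, hR_skew2, neg_neg]
  have hbianchi (Y W : V) : (R.flip Y).flip W = (R.flip W).flip Y - R Y W := by
    ext X
    have h1 : R X W Y = -R W X Y := by
      refine eq_of_sub_eq_zero (hg_nd.1 _ fun Z => ?_)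
      rw [map_sub, map_neg, LinearMap.sub_apply, LinearMap.neg_apply, hR_skew1]
      ring
    simp only [flip_apply, LinearMap.sub_apply]
    rw [h1, ← sub_eq_zero, ← hR_bianchi X Y W]
    abel
  have hhR_ric (Y Z : V) := trace_h_defect_left g 1 κ μ ξ η φ h
    ((R.flip Y).flip (h Z) - h ∘ₗ (R.flip Y).flip Z) Y Z (fun X => by simpa using hhR X Y Z)
  have hhR_comp (A : V →ₗ[ℝ] V) (Y Z : V) := trace_h_defect_comp g 1 κ μ ξ η φ h A
    (R Y Z ∘ₗ h - h ∘ₗ R Y Z) Y Z (fun X => by simpa using hhR Y Z X)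
  have hφR_comp (A : V →ₗ[ℝ] V) (Y Z : V) := trace_comp_phi_defect g 1 κ μ ξ η φ h A
    ((R.flip Y).flip (φ Z) - φ ∘ₗ (R.flip Y).flip Z) Y Z (fun X => by
      rw [LinearMap.sub_apply, comp_apply, flip_apply, flip_apply, flip_apply, flip_apply,
        hφR X Y Z]
      module)
  have htr_φR (Y W : V) : 2 * (1 - κ) * trace ℝ V (φ ∘ₗ R Y W)
      = trace ℝ V ((R Y W ∘ₗ h - h ∘ₗ R Y W) ∘ₗ (h ∘ₗ φ)) := by
    have h1 : h ∘ₗ h ∘ₗ φ = (1 - κ) • φ := by ext X; simp [hhh, hηφ]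
    have h2 : trace ℝ V ((h ∘ₗ R Y W) ∘ₗ (h ∘ₗ φ)) = trace ℝ V (R Y W ∘ₗ (h ∘ₗ φ ∘ₗ h)) := by
      rw [comp_assoc, trace_comp_comm' (R Y W ∘ₗ h ∘ₗ φ) h]; rfl
    rw [sub_comp, map_sub, h2, hhφh, comp_assoc, h1, comp_neg, comp_smul, map_neg,
      map_smul, trace_comp_comm' (R Y W) φ, smul_eq_mul]
    ring
  have htr_hφR (Y W : V) : 2 * trace ℝ V ((h ∘ₗ φ) ∘ₗ R Y W)
      = trace ℝ V ((R Y W ∘ₗ h - h ∘ₗ R Y W) ∘ₗ φ) := by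
    have h1 : φ ∘ₗ h = -(h ∘ₗ φ) := by ext X; simp [hhφ]
    have h2 : trace ℝ V ((h ∘ₗ R Y W) ∘ₗ φ) = trace ℝ V (R Y W ∘ₗ (φ ∘ₗ h)) := by
      rw [comp_assoc, trace_comp_comm' (R Y W ∘ₗ φ) h]; rfl
    rw [trace_comp_comm' (R Y W) (h ∘ₗ φ), sub_comp, map_sub, h2, h1, comp_neg, map_neg,
      comp_assoc]
    ring
  have hric_add (Y Z : V) : trace ℝ V ((R.flip Y).flip Z)
      + trace ℝ V ((R.flip (φ Z)).flip (φ Y))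
      = 2 * (2 * ((n : ℝ) - 1) - n * μ) * (g Y Z - η Y * η Z) + 2 * n * κ * (η Y * η Z) := by
    have h0 : (φ ∘ₗ φ) ∘ₗ (R.flip Y).flip Z
        = -(R.flip Y).flip Z + (η ∘ₗ (R.flip Y).flip Z).smulRight ξ := by
      ext X; simp [hφ_sq]
    have h1 := hφR_comp φ Y Z
    have h2 := hφR_comp LinearMap.id (φ Z) Y
    have h3 := htr_φR Y (φ Z)
    rw [hhR_comp] at h3
    rw [hbianchi, comp_sub, comp_sub, ← comp_assoc, h0] at h1
    simp only [map_add, map_sub, map_smul, map_neg, trace_smulRight, comp_apply, flip_apply,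
      id_comp,
      id_apply, one_mul, one_smul, trace_id, hφhhφ, tφφh, tφh, tφφ, th, tφ, hφ_sq, hhφ, hhh,
        hφ_skew, hηφ, hηh, hηξ, hφξ,
      hh_ξ, hh_sym, hgξ, hgξ', hRξξ, hdim, LinearMap.add_apply, LinearMap.sub_apply,
      LinearMap.neg_apply, LinearMap.smul_apply, LinearMap.zero_apply, map_zero, smul_eq_mul,
      hg_symm Z] at h1 h2 h3 ⊢
    push_cast at h1 h2 h3
    have h4 : (1 - κ) ≠ 0 := by linarith
    have h5 : trace ℝ V (φ ∘ₗ R Y (φ Z)) = -(2 * κ + 2 * n * μ) * (g Y Z - η Y * η Z) :=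
      mul_left_cancel₀ h4 (by linear_combination h3 / 2)
    linear_combination h1 + h2 + h5
  have hsub (Y Z : V) : trace ℝ V ((R.flip Y).flip (h Z))
      - trace ℝ V ((R.flip (φ Z)).flip (φ (h Y)))
      = 2 * (2 * ((n : ℝ) - 1) + μ) * (1 - κ) * (g Y Z - η Y * η Z) := by
    have h0 : ((h ∘ₗ φ) ∘ₗ φ) ∘ₗ (R.flip Y).flip Z = -(h ∘ₗ (R.flip Y).flip Z) := by
      ext X; simp [hφ_sq, hh_ξ]
    have h1 := hφR_comp (h ∘ₗ φ) Y Z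
    have h2 := hφR_comp h (φ Z) Y
    have h3 := htr_hφR Y (φ Z)
    have h5 := hhR_ric Y Z
    have h6 := hhR_ric (φ Z) (φ Y)
    rw [hhR_comp] at h3
    rw [hbianchi, comp_sub, comp_sub, ← comp_assoc _ φ, h0] at h1
    simp only [map_add, map_sub, map_smul, map_neg, comp_apply, comp_sub, comp_neg, comp_assoc,
      one_mul, one_smul, hhφh, tφhφ, tφφh, thφφ, thφ, tφh, thh, th, tφ, hφ_sq, hhφ, hhh, hφ_skew,
      hηφ, hηh, hηξ, hφξ,
      hh_ξ, hh_sym, hgξ, hgξ', hdim, LinearMap.add_apply, LinearMap.sub_apply,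
      LinearMap.neg_apply, LinearMap.smul_apply, LinearMap.zero_apply, map_zero, smul_eq_mul,
      hg_symm Z, hric_h_symm (φ Z)] at h1 h2 h3 h5 h6 ⊢
    push_cast at h5
    linear_combination h1 + h2 + h3 / 2 + h5 + h6
  have hric_comm (Y Z : V) : trace ℝ V ((R.flip (h Y)).flip Z)
      = trace ℝ V ((R.flip Y).flip (h Z)) := by
    have h1 := hhR_ric Y Z
    have h2 := hhR_ric Z Y
    have h3 := hric_h_symm Y Z
    have h4 := hric_symm (h Y) Z
    simp only [map_sub, map_neg, hhφ, hφ_skew, hφ_sq, hηh, hh_ξ, hgξ, hh_sym, map_add,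
      map_zero, map_smul, LinearMap.add_apply, LinearMap.neg_apply, LinearMap.smul_apply, zero_smul,
        LinearMap.zero_apply, tφ, tφh, th, hηξ, smul_eq_mul, hg_symm Z] at h1 h2
    linear_combination h4 + h2 - h1 - h3
  have hric_h (Y Z : V) : trace ℝ V ((R.flip Y).flip (h Z))
      = (2 * ((n : ℝ) - 1) - n * μ) * g (h Y) Z
        + (2 * ((n : ℝ) - 1) + μ) * (1 - κ) * (g Y Z - η Y * η Z) := by
    have h1 := hric_add (h Y) Z
    rw [hηh] at h1
    linear_combination (h1 + hsub Y Z - hric_comm Y Z) / 2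
  have hric (Y Z : V) : trace ℝ V ((R.flip Y).flip Z)
      = (2 * ((n : ℝ) - 1) - n * μ) * g Y Z + (2 * ((n : ℝ) - 1) + μ) * g (h Y) Z
        + (2 * (1 - (n : ℝ)) + 2 * n * κ + n * μ) * (η Y * η Z) := by
    have h1 := hric_h Y (h Z)
    rw [hhh, hh_sym, hhh, hηh] at h1
    simp only [map_sub, map_smul, smul_eq_mul, hric_ξ, hgξ', ← hh_sym] at h1
    have h2 : 1 - κ ≠ 0 := by linarith
    exact mul_left_cancel₀ h2 (by linear_combination h1)
  refine ⟨fun X Y => by rw [hric]; ring, fun Q hQ X => ?_⟩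
  refine eq_of_sub_eq_zero (hg_nd.1 _ fun Y => ?_)
  simp only [map_sub, map_add, map_smul, LinearMap.sub_apply, LinearMap.add_apply,
    LinearMap.smul_apply, smul_eq_mul, hQ, hric, hgξ]
  ring
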